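/- For every 1 ≤ r ≤ N−2 and every i ∈ {1,2,3,4}, ‖[[T_r^(i), D_{r+1}], D_{r+1}]‖ ≤ x·μ²/2. -/

import Mathlib

open Matrix Complex

noncomputable section

/-- The spectral (ℓ²-operator) norm of a complex square matrix. -/
def specNorm {n : Type*} [Fintype n] [DecidableEq n] (M : Matrix n n ℂ) : ℝ :=
  ‖Matrix.toEuclideanCLM (𝕜 := ℂ) M‖

/-- Pauli X. -/
def PX : Matrix (Fin 2) (Fin 2) ℂ := !![0, 1; 1, 0]
/-- Pauli Y. -/
def PY : Matrix (Fin 2) (Fin 2) ℂ := !![0, -I; I, 0]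
/-- Pauli Z. -/
def PZ : Matrix (Fin 2) (Fin 2) ℂ := !![1, 0; 0, -1]

/-- Electric field operator `E |j⟩ = (j - Λ)|j⟩` on `ℂ^(2^η)`, `Λ = 2^(η-1)`. -/
def Eop (η : ℕ) : Matrix (Fin (2 ^ η)) (Fin (2 ^ η)) ℂ :=
  Matrix.diagonal fun j => ((j : ℕ) : ℂ) - ((2 ^ (η - 1) : ℕ) : ℂ)

/-- Link operator `U |j⟩ = |j + 1 mod 2^η⟩`. -/
def Uop (η : ℕ) : Matrix (Fin (2 ^ η)) (Fin (2 ^ η)) ℂ :=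
  Matrix.of fun j k => if (j : ℕ) = ((k : ℕ) + 1) % 2 ^ η then 1 else 0

/-- `A |j⟩ = |j XOR 1⟩`. -/
def Aop (η : ℕ) : Matrix (Fin (2 ^ η)) (Fin (2 ^ η)) ℂ :=
  Matrix.of fun j k => if (j : ℕ) = (k : ℕ) ^^^ 1 then 1 else 0

/-- `B |j⟩ = i (-1)^j |j XOR 1⟩`. -/
def Bop (η : ℕ) : Matrix (Fin (2 ^ η)) (Fin (2 ^ η)) ℂ :=
  Matrix.of fun j k => if (j : ℕ) = (k : ℕ) ^^^ 1 then I * (-1) ^ (k : ℕ) else 0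

/-- Configurations of the lattice: a qubit for each of the `N` sites (0-indexed; the paper's
site `r` is index `r - 1`) and a `2^η`-dimensional register for each of the `N - 1` links
(0-indexed; the paper's link `r` is index `r - 1`). -/
abbrev Config (N η : ℕ) := (Fin N → Fin 2) × (Fin (N - 1) → Fin (2 ^ η))

/-- Operators on the lattice Hilbert space `(ℂ²)^{⊗N} ⊗ (ℂ^{2Λ})^{⊗(N-1)}`. -/
abbrev LatOp (N η : ℕ) := Matrix (Config N η) (Config N η) ℂ

/-- A single-qubit operator `M` acting on the `r`-th site factor. -/
def siteOp (N η : ℕ) (r : Fin N) (M : Matrix (Fin 2) (Fin 2) ℂ) : LatOp N η :=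
  Matrix.of fun p q =>
    if p.2 = q.2 ∧ ∀ s, s ≠ r → p.1 s = q.1 s then M (p.1 r) (q.1 r) else 0

/-- A single-link operator `M` acting on the `r`-th link factor. -/
def linkOp (N η : ℕ) (r : Fin (N - 1)) (M : Matrix (Fin (2 ^ η)) (Fin (2 ^ η)) ℂ) :
    LatOp N η :=
  Matrix.of fun p q =>
    if p.1 = q.1 ∧ ∀ s, s ≠ r → p.2 s = q.2 s then M (p.2 r) (q.2 r) else 0

/-- For the `r`-th link (0-indexed), the site on its left, as an index into `Fin N`. -/
def siteL {N : ℕ} (r : Fin (N - 1)) : Fin N := ⟨r.1, by have := r.2; omega⟩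

/-- For the `r`-th link (0-indexed), the site on its right, as an index into `Fin N`. -/
def siteR {N : ℕ} (r : Fin (N - 1)) : Fin N := ⟨r.1 + 1, by have := r.2; omega⟩

/-- `X_r X_{r+1} + Y_r Y_{r+1}` (paper indices; `r` is the 0-indexed link). -/
def Gop (N η : ℕ) (r : Fin (N - 1)) : LatOp N η :=
  siteOp N η (siteL r) PX * siteOp N η (siteR r) PX
    + siteOp N η (siteL r) PY * siteOp N η (siteR r) PY

/-- `X_r Y_{r+1} - Y_r X_{r+1}` (paper indices; `r` is the 0-indexed link). -/
def Gtilde (N η : ℕ) (r : Fin (N - 1)) : LatOp N η :=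
  siteOp N η (siteL r) PX * siteOp N η (siteR r) PY
    - siteOp N η (siteL r) PY * siteOp N η (siteR r) PX

/-- The four hopping terms `T_r^(1), …, T_r^(4)` (`j = 0,…,3` is the paper's `j = 1,…,4`;
`r` is the 0-indexed link, the paper's site/link `r+1`). -/
def Thop (N η : ℕ) (x : ℝ) (r : Fin (N - 1)) : Fin 4 → LatOp N η
  | 0 => ((x : ℂ) / 4) • (linkOp N η r (Aop η) * Gop N η r)
  | 1 => ((x : ℂ) / 4) • (linkOp N η r ((Uop η)ᴴ * Aop η * Uop η) * Gop N η r)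
  | 2 => ((x : ℂ) / 4) • (linkOp N η r ((Uop η)ᴴ * Bop η * Uop η) * Gtilde N η r)
  | 3 => ((x : ℂ) / 4) • (linkOp N η r (Bop η) * Gtilde N η r)

/-- Mass term `D_r^(M) = -(μ/2) (-1)^r Z_r` at the 0-indexed site `i` (paper's site `r = i+1`). -/
def DM (N η : ℕ) (μ : ℝ) (i : Fin N) : LatOp N η :=
  ((-(μ : ℂ) / 2) * (-1) ^ ((i : ℕ) + 1)) • siteOp N η i PZ

/-- Electric term `D_r^(E) = E_r²` at the 0-indexed link `r`. -/
def DE (N η : ℕ) (r : Fin (N - 1)) : LatOp N η := (linkOp N η r (Eop η)) ^ 2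

/-- `D_r = D_r^(M) + D_r^(E)` for the paper's `1 ≤ r ≤ N - 1` (`r` the 0-indexed link). -/
def Dlink (N η : ℕ) (μ : ℝ) (r : Fin (N - 1)) : LatOp N η :=
  DM N η μ (siteL r) + DE N η r

end
open scoped Matrix.Norms.L2Operator

lemma specNorm_eq_l2OpNorm {n : Type*} [Fintype n] [DecidableEq n] (M : Matrix n n ℂ) :
    specNorm M = ‖M‖ := rfl

lemma siteOp_mulVec (N η : ℕ) (r : Fin N) (M : Matrix (Fin 2) (Fin 2) ℂ) (v : Config N η → ℂ)
    (p : Config N η) :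
    (siteOp N η r M *ᵥ v) p = ∑ j, M (p.1 r) j * v (Function.update p.1 r j, p.2) := by
  symm
  refine Fintype.sum_of_injective (fun j => (Function.update p.1 r j, p.2)) ?_ _ _ ?_ ?_
  · intro a b hab
    exact Function.update_injective p.1 r (Prod.ext_iff.1 hab).1
  · intro q hq
    have : ¬ (p.2 = q.2 ∧ ∀ s, s ≠ r → p.1 s = q.1 s) := by
      rintro ⟨h2, h1⟩
      refine hq ⟨q.1 r, Prod.ext (funext fun s => ?_) h2⟩
      by_cases hs : s = r
      · subst hs; simp
      · simp [hs, h1 s hs]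
    simp [siteOp, this]
  · intro j
    have : ∀ s, s ≠ r → p.1 s = Function.update p.1 r j s := fun s hs => by simp [hs]
    simp only [siteOp, Matrix.of_apply, true_and, if_pos this, Function.update_self]

lemma linkOp_mulVec (N η : ℕ) (r : Fin (N - 1)) (M : Matrix (Fin (2 ^ η)) (Fin (2 ^ η)) ℂ)
    (v : Config N η → ℂ) (p : Config N η) :
    (linkOp N η r M *ᵥ v) p = ∑ j, M (p.2 r) j * v (p.1, Function.update p.2 r j) := by
  symm
  refine Fintype.sum_of_injective (fun j => (p.1, Function.update p.2 r j)) ?_ _ _ ?_ ?_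
  · intro a b hab
    exact Function.update_injective p.2 r (Prod.ext_iff.1 hab).2
  · intro q hq
    have : ¬ (p.1 = q.1 ∧ ∀ s, s ≠ r → p.2 s = q.2 s) := by
      rintro ⟨h1, h2⟩
      refine hq ⟨q.2 r, Prod.ext h1 (funext fun s => ?_)⟩
      by_cases hs : s = r
      · subst hs; simp
      · simp [hs, h2 s hs]
    simp [linkOp, this]
  · intro j
    have : ∀ s, s ≠ r → p.2 s = Function.update p.2 r j s := fun s hs => by simp [hs]
    simp only [linkOp, Matrix.of_apply, true_and, if_pos this, Function.update_self]

lemma siteOp_mul (N η : ℕ) (r : Fin N) (M M' : Matrix (Fin 2) (Fin 2) ℂ) :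
    siteOp N η r M * siteOp N η r M' = siteOp N η r (M * M') := by
  refine Matrix.ext_of_mulVec_single fun q => ?_
  rw [← Matrix.mulVec_mulVec]
  generalize (Pi.single q 1 : Config N η → ℂ) = v
  funext p
  simp only [siteOp_mulVec, Function.update_self, Function.update_idem, Matrix.mul_apply,
    Finset.mul_sum, Finset.sum_mul, mul_assoc]
  exact Finset.sum_comm

lemma linkOp_mul (N η : ℕ) (r : Fin (N - 1)) (M M' : Matrix (Fin (2 ^ η)) (Fin (2 ^ η)) ℂ) :
    linkOp N η r M * linkOp N η r M' = linkOp N η r (M * M') := by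
  refine Matrix.ext_of_mulVec_single fun q => ?_
  rw [← Matrix.mulVec_mulVec]
  generalize (Pi.single q 1 : Config N η → ℂ) = v
  funext p
  simp only [linkOp_mulVec, Function.update_self, Function.update_idem, Matrix.mul_apply,
    Finset.mul_sum, Finset.sum_mul, mul_assoc]
  exact Finset.sum_comm

lemma siteOp_commute (N η : ℕ) {r s : Fin N} (hrs : r ≠ s) (M M' : Matrix (Fin 2) (Fin 2) ℂ) :
    Commute (siteOp N η r M) (siteOp N η s M') := by
  refine Matrix.ext_of_mulVec_single fun q => ?_
  rw [← Matrix.mulVec_mulVec, ← Matrix.mulVec_mulVec]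
  generalize (Pi.single q 1 : Config N η → ℂ) = v
  funext p
  simp only [siteOp_mulVec, Function.update_of_ne hrs, Function.update_of_ne hrs.symm,
    Finset.mul_sum]
  rw [Finset.sum_comm]
  refine Finset.sum_congr rfl fun i _ => Finset.sum_congr rfl fun j _ => ?_
  rw [Function.update_comm hrs, mul_left_comm]

lemma linkOp_commute (N η : ℕ) {r s : Fin (N - 1)} (hrs : r ≠ s)
    (M M' : Matrix (Fin (2 ^ η)) (Fin (2 ^ η)) ℂ) :
    Commute (linkOp N η r M) (linkOp N η s M') := by
  refine Matrix.ext_of_mulVec_single fun q => ?_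
  rw [← Matrix.mulVec_mulVec, ← Matrix.mulVec_mulVec]
  generalize (Pi.single q 1 : Config N η → ℂ) = v
  funext p
  simp only [linkOp_mulVec, Function.update_of_ne hrs, Function.update_of_ne hrs.symm,
    Finset.mul_sum]
  rw [Finset.sum_comm]
  refine Finset.sum_congr rfl fun i _ => Finset.sum_congr rfl fun j _ => ?_
  rw [Function.update_comm hrs, mul_left_comm]

lemma linkOp_commute_siteOp (N η : ℕ) (r : Fin (N - 1)) (s : Fin N)
    (M : Matrix (Fin (2 ^ η)) (Fin (2 ^ η)) ℂ) (M' : Matrix (Fin 2) (Fin 2) ℂ) :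
    Commute (linkOp N η r M) (siteOp N η s M') := by
  refine Matrix.ext_of_mulVec_single fun q => ?_
  rw [← Matrix.mulVec_mulVec, ← Matrix.mulVec_mulVec]
  generalize (Pi.single q 1 : Config N η → ℂ) = v
  funext p
  simp only [linkOp_mulVec, siteOp_mulVec, Finset.mul_sum]
  rw [Finset.sum_comm]
  refine Finset.sum_congr rfl fun i _ => Finset.sum_congr rfl fun j _ => ?_
  rw [mul_left_comm]

lemma siteOp_one (N η : ℕ) (r : Fin N) : siteOp N η r 1 = 1 := by
  refine Matrix.ext_of_mulVec_single fun q => ?_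
  rw [Matrix.one_mulVec]
  generalize (Pi.single q 1 : Config N η → ℂ) = v
  funext p
  simp [siteOp_mulVec, Matrix.one_apply, -Fin.sum_univ_two]

lemma linkOp_one (N η : ℕ) (r : Fin (N - 1)) : linkOp N η r 1 = 1 := by
  refine Matrix.ext_of_mulVec_single fun q => ?_
  rw [Matrix.one_mulVec]
  generalize (Pi.single q 1 : Config N η → ℂ) = v
  funext p
  simp [linkOp_mulVec, Matrix.one_apply]

lemma siteOp_neg (N η : ℕ) (r : Fin N) (M : Matrix (Fin 2) (Fin 2) ℂ) :
    siteOp N η r (-M) = -siteOp N η r M := by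
  ext p q
  simp only [siteOp, Matrix.of_apply, Matrix.neg_apply]
  split_ifs <;> simp

lemma star_siteOp (N η : ℕ) (r : Fin N) (M : Matrix (Fin 2) (Fin 2) ℂ) :
    star (siteOp N η r M) = siteOp N η r (star M) := by
  ext p q
  simp only [siteOp, Matrix.of_apply, Matrix.star_apply, apply_ite star, star_zero,
    eq_comm (a := p.2), eq_comm (a := p.1 _)]

lemma star_linkOp (N η : ℕ) (r : Fin (N - 1)) (M : Matrix (Fin (2 ^ η)) (Fin (2 ^ η)) ℂ) :
    star (linkOp N η r M) = linkOp N η r (star M) := by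
  ext p q
  simp only [linkOp, Matrix.of_apply, Matrix.star_apply, apply_ite star, star_zero,
    eq_comm (a := p.1), eq_comm (a := p.2 _)]

lemma siteOp_mem_unitaryGroup (N η : ℕ) (r : Fin N) {M : Matrix (Fin 2) (Fin 2) ℂ}
    (hM : M ∈ Matrix.unitaryGroup (Fin 2) ℂ) :
    siteOp N η r M ∈ Matrix.unitaryGroup (Config N η) ℂ := by
  rw [Matrix.mem_unitaryGroup_iff', star_siteOp, siteOp_mul, Matrix.mem_unitaryGroup_iff'.1 hM,
    siteOp_one]

lemma linkOp_mem_unitaryGroup (N η : ℕ) (r : Fin (N - 1))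
    {M : Matrix (Fin (2 ^ η)) (Fin (2 ^ η)) ℂ}
    (hM : M ∈ Matrix.unitaryGroup (Fin (2 ^ η)) ℂ) :
    linkOp N η r M ∈ Matrix.unitaryGroup (Config N η) ℂ := by
  rw [Matrix.mem_unitaryGroup_iff', star_linkOp, linkOp_mul, Matrix.mem_unitaryGroup_iff'.1 hM,
    linkOp_one]

lemma PX_mem_unitaryGroup : PX ∈ Matrix.unitaryGroup (Fin 2) ℂ := by
  rw [Matrix.mem_unitaryGroup_iff']
  ext i j
  fin_cases i <;> fin_cases j <;> simp [PX, Matrix.mul_apply, Matrix.star_apply]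

lemma PY_mem_unitaryGroup : PY ∈ Matrix.unitaryGroup (Fin 2) ℂ := by
  rw [Matrix.mem_unitaryGroup_iff']
  ext i j
  fin_cases i <;> fin_cases j <;> simp [PY, Matrix.mul_apply, Matrix.star_apply]

lemma PZ_mul_PZ : PZ * PZ = 1 := by
  ext i j
  fin_cases i <;> fin_cases j <;> simp [PZ, Matrix.mul_apply]

lemma PX_mul_PZ : PX * PZ = -(PZ * PX) := by
  ext i j
  fin_cases i <;> fin_cases j <;> simp [PX, PZ, Matrix.mul_apply]

lemma PY_mul_PZ : PY * PZ = -(PZ * PY) := by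
  ext i j
  fin_cases i <;> fin_cases j <;> simp [PY, PZ, Matrix.mul_apply]

/-- A monomial matrix with unimodular entries is unitary. -/
lemma monomial_mem_unitaryGroup {n : ℕ} (g : Fin n → ℕ) (hg : ∀ k, g k < n)
    (hinj : Function.Injective g) (c : Fin n → ℂ) (hc : ∀ k, star (c k) * c k = 1) :
    (Matrix.of fun j k : Fin n => if (j : ℕ) = g k then c k else 0) ∈
      Matrix.unitaryGroup (Fin n) ℂ := by
  rw [Matrix.mem_unitaryGroup_iff']
  ext j k
  have key : ∀ i l : Fin n, ((i : ℕ) = g l) ↔ i = ⟨g l, hg l⟩ := fun i l => by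
    rw [Fin.ext_iff]
  simp only [Matrix.mul_apply, Matrix.star_apply, Matrix.of_apply, key]
  by_cases hjk : j = k
  · subst hjk
    simpa using hc j
  · have : g k ≠ g j := fun h => hjk (hinj h.symm)
    simp [hjk, this]

lemma Aop_mem_unitaryGroup {η : ℕ} (hη : 1 ≤ η) :
    Aop η ∈ Matrix.unitaryGroup (Fin (2 ^ η)) ℂ :=
  monomial_mem_unitaryGroup (fun k => (k : ℕ) ^^^ 1)
    (fun k => Nat.xor_lt_two_pow k.2 (Nat.one_lt_two_pow (by omega)))
    (fun _ _ h => Fin.ext (Nat.xor_left_injective h)) (fun _ => 1) (by simp)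

lemma Bop_mem_unitaryGroup {η : ℕ} (hη : 1 ≤ η) :
    Bop η ∈ Matrix.unitaryGroup (Fin (2 ^ η)) ℂ :=
  monomial_mem_unitaryGroup (fun k => (k : ℕ) ^^^ 1)
    (fun k => Nat.xor_lt_two_pow k.2 (Nat.one_lt_two_pow (by omega)))
    (fun _ _ h => Fin.ext (Nat.xor_left_injective h)) (fun k => I * (-1) ^ (k : ℕ))
    (fun k => by rcases neg_one_pow_eq_or ℂ (k : ℕ) with h | h <;> simp [h])

lemma Uop_mem_unitaryGroup (η : ℕ) : Uop η ∈ Matrix.unitaryGroup (Fin (2 ^ η)) ℂ :=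
  monomial_mem_unitaryGroup (fun k => ((k : ℕ) + 1) % 2 ^ η)
    (fun _ => Nat.mod_lt _ (by positivity))
    (fun a b h => Fin.ext (Nat.ModEq.eq_of_lt_of_lt (Nat.ModEq.add_right_cancel' 1 h) a.2 b.2))
    (fun _ => 1) (by simp)

lemma Uop_conj_mem_unitaryGroup {η : ℕ} {M : Matrix (Fin (2 ^ η)) (Fin (2 ^ η)) ℂ}
    (hM : M ∈ Matrix.unitaryGroup (Fin (2 ^ η)) ℂ) :
    (Uop η)ᴴ * M * Uop η ∈ Matrix.unitaryGroup (Fin (2 ^ η)) ℂ :=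
  mul_mem (mul_mem (Unitary.star_mem (Uop_mem_unitaryGroup η)) hM) (Uop_mem_unitaryGroup η)

lemma norm_siteOp_mul_siteOp (N η : ℕ) (r s : Fin N) {M M' : Matrix (Fin 2) (Fin 2) ℂ}
    (hM : M ∈ Matrix.unitaryGroup (Fin 2) ℂ) (hM' : M' ∈ Matrix.unitaryGroup (Fin 2) ℂ) :
    ‖siteOp N η r M * siteOp N η s M'‖ = 1 :=
  CStarRing.norm_of_mem_unitary
    (mul_mem (siteOp_mem_unitaryGroup N η r hM) (siteOp_mem_unitaryGroup N η s hM'))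

lemma norm_Gop_le (N η : ℕ) (r : Fin (N - 1)) : ‖Gop N η r‖ ≤ 2 := by
  refine (norm_add_le _ _).trans ?_
  rw [norm_siteOp_mul_siteOp _ _ _ _ PX_mem_unitaryGroup PX_mem_unitaryGroup,
    norm_siteOp_mul_siteOp _ _ _ _ PY_mem_unitaryGroup PY_mem_unitaryGroup]
  norm_num

lemma norm_Gtilde_le (N η : ℕ) (r : Fin (N - 1)) : ‖Gtilde N η r‖ ≤ 2 := by
  refine (norm_sub_le _ _).trans ?_
  rw [norm_siteOp_mul_siteOp _ _ _ _ PX_mem_unitaryGroup PY_mem_unitaryGroup,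
    norm_siteOp_mul_siteOp _ _ _ _ PY_mem_unitaryGroup PX_mem_unitaryGroup]
  norm_num

lemma siteL_ne_siteR {N : ℕ} (r : Fin (N - 1)) : siteL r ≠ siteR r := by
  simp [siteL, siteR, Fin.ext_iff]

lemma siteOp_mul_siteOp_anticomm (N η : ℕ) {r s : Fin N} (hrs : r ≠ s)
    (M : Matrix (Fin 2) (Fin 2) ℂ) {M' P : Matrix (Fin 2) (Fin 2) ℂ} (h : M' * P = -(P * M')) :
    siteOp N η r M * siteOp N η s M' * siteOp N η s P =
      -(siteOp N η s P * (siteOp N η r M * siteOp N η s M')) := by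
  rw [mul_assoc, siteOp_mul, h, siteOp_neg, ← siteOp_mul, mul_neg, ← mul_assoc, ← mul_assoc,
    (siteOp_commute N η hrs M P).eq]

lemma Gop_mul_siteOp_PZ (N η : ℕ) (r : Fin (N - 1)) :
    Gop N η r * siteOp N η (siteR r) PZ = -(siteOp N η (siteR r) PZ * Gop N η r) := by
  rw [Gop, add_mul, mul_add,
    siteOp_mul_siteOp_anticomm N η (siteL_ne_siteR r) PX PX_mul_PZ,
    siteOp_mul_siteOp_anticomm N η (siteL_ne_siteR r) PY PY_mul_PZ, neg_add]

lemma Gtilde_mul_siteOp_PZ (N η : ℕ) (r : Fin (N - 1)) :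
    Gtilde N η r * siteOp N η (siteR r) PZ = -(siteOp N η (siteR r) PZ * Gtilde N η r) := by
  rw [Gtilde, sub_mul, mul_sub,
    siteOp_mul_siteOp_anticomm N η (siteL_ne_siteR r) PX PY_mul_PZ,
    siteOp_mul_siteOp_anticomm N η (siteL_ne_siteR r) PY PX_mul_PZ, neg_sub_neg, neg_sub]

lemma linkOp_commute_Gop (N η : ℕ) (r s : Fin (N - 1))
    (M : Matrix (Fin (2 ^ η)) (Fin (2 ^ η)) ℂ) : Commute (linkOp N η s M) (Gop N η r) :=
  ((linkOp_commute_siteOp ..).mul_right (linkOp_commute_siteOp ..)).add_right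
    ((linkOp_commute_siteOp ..).mul_right (linkOp_commute_siteOp ..))

lemma linkOp_commute_Gtilde (N η : ℕ) (r s : Fin (N - 1))
    (M : Matrix (Fin (2 ^ η)) (Fin (2 ^ η)) ℂ) : Commute (linkOp N η s M) (Gtilde N η r) :=
  ((linkOp_commute_siteOp ..).mul_right (linkOp_commute_siteOp ..)).sub_right
    ((linkOp_commute_siteOp ..).mul_right (linkOp_commute_siteOp ..))

/-- Each hopping term is `x / 4` times a unitary link operator times a site operator of norm at
most `2` that commutes with link operators and anticommutes with `Z` on the right-hand site. -/
lemma Thop_eq_smul_linkOp_mul (N : ℕ) {η : ℕ} (hη : 1 ≤ η) (x : ℝ) (r : Fin (N - 1)) (i : Fin 4) :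
    ∃ (W : Matrix (Fin (2 ^ η)) (Fin (2 ^ η)) ℂ) (G : LatOp N η),
      Thop N η x r i = ((x : ℂ) / 4) • (linkOp N η r W * G) ∧
      W ∈ Matrix.unitaryGroup (Fin (2 ^ η)) ℂ ∧ ‖G‖ ≤ 2 ∧
      (∀ s M, Commute (linkOp N η s M) G) ∧
      G * siteOp N η (siteR r) PZ = -(siteOp N η (siteR r) PZ * G) := by
  have hG := And.intro (norm_Gop_le N η r)
    (And.intro (linkOp_commute_Gop N η r) (Gop_mul_siteOp_PZ N η r))
  have hG' := And.intro (norm_Gtilde_le N η r)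
    (And.intro (linkOp_commute_Gtilde N η r) (Gtilde_mul_siteOp_PZ N η r))
  fin_cases i
  · exact ⟨_, _, rfl, Aop_mem_unitaryGroup hη, hG⟩
  · exact ⟨_, _, rfl, Uop_conj_mem_unitaryGroup (Aop_mem_unitaryGroup hη), hG⟩
  · exact ⟨_, _, rfl, Uop_conj_mem_unitaryGroup (Bop_mem_unitaryGroup hη), hG'⟩
  · exact ⟨_, _, rfl, Bop_mem_unitaryGroup hη, hG'⟩

lemma double_commutator_of_anticomm {R : Type*} [Ring R] [Algebra ℂ R] (c : ℂ) {T Z E : R}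
    (hTZ : T * Z = -(Z * T)) (hZ : Z * Z = 1) (hTE : Commute T E) (hZE : Commute Z E) :
    (T * (c • Z + E) - (c • Z + E) * T) * (c • Z + E)
      - (c • Z + E) * (T * (c • Z + E) - (c • Z + E) * T) = (4 * c ^ 2) • T := by
  have h₁ : T * (c • Z + E) - (c • Z + E) * T = (2 * c) • (T * Z) := by
    rw [mul_add, add_mul, hTE.eq, mul_smul_comm, smul_mul_assoc, ← neg_eq_iff_eq_neg.2 hTZ]
    module
  have h₂ : Commute (T * Z) E := hTE.mul_left hZE
  have h₃ : T * Z * Z = T := by rw [mul_assoc, hZ, mul_one]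
  have h₄ : Z * (T * Z) = -T := by
    rw [← mul_assoc, ← neg_eq_iff_eq_neg.2 hTZ, neg_mul, h₃]
  rw [h₁, mul_add, add_mul, smul_mul_assoc, smul_mul_assoc, mul_smul_comm, mul_smul_comm,
    mul_smul_comm, smul_mul_assoc, h₂.eq, h₃, h₄]
  module

/-- For every `r` with the paper's `1 ≤ r ≤ N-2` (here `r` is the 0-indexed
link and `h` guarantees that `r + 1` is also a valid link index) and every `i ∈ {1,2,3,4}`,
`‖[[T_r^(i), D_{r+1}], D_{r+1}]‖ ≤ x μ² / 2`. -/
theorem double_commutator_T_Dnext_Dnext_bound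
    (N η : ℕ) (hN : 3 ≤ N) (hNeven : Even N) (hη : 1 ≤ η) (x μ : ℝ) (hx : 0 < x) (hμ : 0 ≤ μ)
    (r : Fin (N - 1)) (h : r.1 + 1 < N - 1) (i : Fin 4) :
    specNorm ((Thop N η x r i * Dlink N η μ ⟨r.1 + 1, h⟩
          - Dlink N η μ ⟨r.1 + 1, h⟩ * Thop N η x r i) * Dlink N η μ ⟨r.1 + 1, h⟩
        - Dlink N η μ ⟨r.1 + 1, h⟩ * (Thop N η x r i * Dlink N η μ ⟨r.1 + 1, h⟩
          - Dlink N η μ ⟨r.1 + 1, h⟩ * Thop N η x r i)) ≤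
      x * μ ^ 2 / 2 := by
  obtain ⟨W, G, hT, hW, hG, hcomm, hanti⟩ := Thop_eq_smul_linkOp_mul N hη x r i
  have hne : r ≠ ⟨r.1 + 1, h⟩ := fun e => by simpa using congrArg Fin.val e
  have hTZ : linkOp N η r W * G * siteOp N η (siteR r) PZ =
      -(siteOp N η (siteR r) PZ * (linkOp N η r W * G)) := by
    rw [mul_assoc, hanti, mul_neg, ← mul_assoc, ← mul_assoc,
      (linkOp_commute_siteOp N η r (siteR r) W PZ).eq]
  have hTE : Commute (linkOp N η r W * G) (DE N η ⟨r.1 + 1, h⟩) :=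
    ((linkOp_commute N η hne W (Eop η)).mul_left (hcomm _ (Eop η)).symm).pow_right 2
  have hZE : Commute (siteOp N η (siteR r) PZ) (DE N η ⟨r.1 + 1, h⟩) :=
    (linkOp_commute_siteOp N η _ _ _ _).symm.pow_right 2
  have hZ : siteOp N η (siteR r) PZ * siteOp N η (siteR r) PZ = 1 := by
    rw [siteOp_mul, PZ_mul_PZ, siteOp_one]
  have hD : Dlink N η μ ⟨r.1 + 1, h⟩ =
      ((-(μ : ℂ) / 2) * (-1) ^ ((siteR r : ℕ) + 1)) • siteOp N η (siteR r) PZ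
        + DE N η ⟨r.1 + 1, h⟩ := rfl
  have hc : 4 * ((-(μ : ℂ) / 2) * (-1) ^ ((siteR r : ℕ) + 1)) ^ 2 = ((μ ^ 2 : ℝ) : ℂ) := by
    rcases neg_one_pow_eq_or ℂ ((siteR r : ℕ) + 1) with e | e <;> rw [e] <;> push_cast <;> ring
  have hnorm : ‖linkOp N η r W * G‖ ≤ 2 := by
    refine (norm_mul_le _ _).trans ?_
    rw [CStarRing.norm_of_mem_unitary (linkOp_mem_unitaryGroup N η r hW), one_mul]
    exact hG
  have hx4 : (x : ℂ) / 4 = ((x / 4 : ℝ) : ℂ) := by push_cast; rfl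
  rw [specNorm_eq_l2OpNorm, hT, hD,
    double_commutator_of_anticomm _ (by rw [smul_mul_assoc, hTZ, mul_smul_comm, smul_neg]) hZ
      (hTE.smul_left _) hZE, hc, norm_smul, hx4, norm_smul, Complex.norm_real, Complex.norm_real,
    Real.norm_of_nonneg (sq_nonneg μ), Real.norm_of_nonneg (by positivity)]
  calc μ ^ 2 * (x / 4 * ‖linkOp N η r W * G‖) ≤ μ ^ 2 * (x / 4 * 2) := by gcongr
    _ = x * μ ^ 2 / 2 := by ring
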